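/- Let n̄ = (n₁,…,n_r) with 1 ≤ n₁ ≤ ··· ≤ n_r and r ≥ 2. Then the (reduced) topological complexity satisfies TC(P_{n̄}) ≤ 2|n̄| - n₁ + 1, where |n̄| = Σᵢ nᵢ = dim P_{n̄}. -/

import Mathlib

noncomputable section

open unitInterval Set

/-- The double evaluation map `X^{[0,1]} → X × X`, sending a path `γ : [0,1] → X`
to the pair of its endpoints `(γ(0), γ(1))`. -/
def pathEval (X : Type*) [TopologicalSpace X] (γ : C(I, X)) : X × X := (γ 0, γ 1)

/-- `X × X` admits a cover by `k + 1` open sets on each of which the double evaluation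
map `X^{[0,1]} → X × X` admits a continuous section. -/
def TCCover (X : Type*) [TopologicalSpace X] (k : ℕ) : Prop :=
  ∃ U : Fin (k + 1) → Set (X × X),
    (∀ i, IsOpen (U i)) ∧ (⋃ i, U i) = Set.univ ∧
    ∀ i, ∃ s : C(U i, C(I, X)), ∀ u : U i, pathEval X (s u) = (u : X × X)

/-- Farber's (reduced) topological complexity, as an element of `ℕ∞`. -/
def topComplexity (X : Type*) [TopologicalSpace X] : ℕ∞ :=
  sInf {c : ℕ∞ | ∃ k : ℕ, TCCover X k ∧ c = k}

/-- `X × X` admits a cover by `k + 1` `G`-invariant open sets (for the diagonal `G`-action)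
on each of which the double evaluation map admits a continuous `G`-equivariant section. -/
def EqTCCover (G X : Type*) [Group G] [TopologicalSpace X] [MulAction G X] (k : ℕ) : Prop :=
  ∃ U : Fin (k + 1) → Set (X × X),
    (∀ i, IsOpen (U i)) ∧ (⋃ i, U i) = Set.univ ∧
    (∀ i (g : G) p, p ∈ U i → g • p ∈ U i) ∧
    ∀ i, ∃ s : C(U i, C(I, X)),
      (∀ u : U i, pathEval X (s u) = (u : X × X)) ∧
      ∀ (g : G) (u : U i) (hg : g • (u : X × X) ∈ U i) (t : I),
        (s ⟨g • (u : X × X), hg⟩) t = g • (s u) t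

/-- The (reduced) equivariant topological complexity `TC_G(X)` of Colman–Grant,
as an element of `ℕ∞`. -/
def eqTC (G X : Type*) [Group G] [TopologicalSpace X] [MulAction G X] : ℕ∞ :=
  sInf {c : ℕ∞ | ∃ k : ℕ, EqTCCover G X k ∧ c = k}

open Metric

/-- `S_{n̄} = S^{n₁} × ⋯ × S^{n_r}`, the product of unit spheres. -/
abbrev SphereProd {r : ℕ} (n : Fin r → ℕ) : Type :=
  Π i : Fin r, Metric.sphere (0 : EuclideanSpace ℝ (Fin (n i + 1))) 1

/-- The setoid on `S_{n̄}` identifying each point with its image under the diagonal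
antipodal involution. -/
def ppsSetoid {r : ℕ} (n : Fin r → ℕ) : Setoid (SphereProd n) :=
  ⟨fun x y => y = x ∨ y = -x, by
    constructor
    · intro x; exact Or.inl rfl
    · rintro x y (rfl | rfl)
      · exact Or.inl rfl
      · right; simp
    · rintro x y z (rfl | rfl) (rfl | rfl)
      · exact Or.inl rfl
      · exact Or.inr rfl
      · exact Or.inr rfl
      · left; simp⟩

/-- Davis' projective product space `P_{n̄}`: the quotient of `S_{n̄}` by the diagonal
(free) antipodal `ℤ/2`-action. -/
def PPS {r : ℕ} (n : Fin r → ℕ) : Type := Quotient (ppsSetoid n)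

instance {r : ℕ} (n : Fin r → ℕ) : TopologicalSpace (PPS n) :=
  instTopologicalSpaceQuotient

/-- The quotient map `S_{n̄} → P_{n̄}`. -/
def ppsMk {r : ℕ} (n : Fin r → ℕ) : SphereProd n → PPS n := Quotient.mk _

/-- The setoid on the sphere `Sᵏ` identifying antipodal points. -/
def rpSetoid (k : ℕ) : Setoid (Metric.sphere (0 : EuclideanSpace ℝ (Fin (k + 1))) 1) :=
  ⟨fun x y => y = x ∨ y = -x, by
    constructor
    · intro x; exact Or.inl rfl
    · rintro x y (rfl | rfl)
      · exact Or.inl rfl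
      · right; simp
    · rintro x y z (rfl | rfl) (rfl | rfl)
      · exact Or.inl rfl
      · exact Or.inr rfl
      · exact Or.inr rfl
      · left; simp⟩

/-- Real projective space `Pᵏ` as the quotient of the sphere `Sᵏ` by the antipodal map. -/
def RP (k : ℕ) : Type := Quotient (rpSetoid k)

instance (k : ℕ) : TopologicalSpace (RP k) := instTopologicalSpaceQuotient

/-- The quotient map `Sᵏ → Pᵏ`. -/
def rpMk (k : ℕ) : Metric.sphere (0 : EuclideanSpace ℝ (Fin (k + 1))) 1 → RP k :=
  Quotient.mk _

/-- A continuous map `g : P_{n̄} × P_{m̄} → Pᵏ` is *axial* if it corresponds to the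
cohomology class `x ⊗ 1 + 1 ⊗ x`; equivalently (and this is the formulation used here),
if it admits a continuous lift `g̃ : S_{n̄} × S_{m̄} → Sᵏ` which is `ℤ/2`-equivariant in
each variable separately: `g̃(-x, y) = g̃(x, -y) = -g̃(x, y)`. -/
def IsAxialMap {r s : ℕ} (n : Fin r → ℕ) (m : Fin s → ℕ) (k : ℕ)
    (g : PPS n × PPS m → RP k) : Prop :=
  Continuous g ∧
  ∃ gt : SphereProd n × SphereProd m →
      Metric.sphere (0 : EuclideanSpace ℝ (Fin (k + 1))) 1,
    Continuous gt ∧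
    (∀ x y, gt (-x, y) = -gt (x, y)) ∧
    (∀ x y, gt (x, -y) = -gt (x, y)) ∧
    (∀ x y, rpMk k (gt (x, y)) = g (ppsMk n x, ppsMk m y))

/-- The point `(1, t, …, t^m)` of the moment curve. -/
def momentVec (m : ℕ) (t : ℝ) : EuclideanSpace ℝ (Fin (m + 1)) :=
  WithLp.toLp 2 fun j => t ^ (j : ℕ)

/-- A nonzero vector is orthogonal to at most `m` points of the moment curve. -/
lemma exists_finset_inner_momentVec_ne_zero {m : ℕ} {x : EuclideanSpace ℝ (Fin (m + 1))}
    (hx : x ≠ 0) :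
    ∃ B : Finset ℝ, B.card ≤ m ∧ ∀ t ∉ B, inner ℝ x (momentVec m t) ≠ 0 := by
  classical
  let p : Polynomial ℝ := ∑ j : Fin (m + 1), Polynomial.monomial (j : ℕ) (x j)
  have hcoeff : ∀ j : Fin (m + 1), p.coeff j = x j := by
    intro j
    simp [p, Polynomial.finsetSum_coeff, Polynomial.coeff_monomial, Fin.val_inj]
  have hp : p ≠ 0 := by
    intro h
    apply hx
    ext j
    rw [← hcoeff j, h]
    simp
  have hdeg : p.natDegree ≤ m := by
    refine Polynomial.natDegree_sum_le_of_forall_le _ _ fun j _ => ?_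
    exact (Polynomial.natDegree_monomial_le _).trans (Nat.lt_succ_iff.mp j.2)
  have heval : ∀ t, p.eval t = inner ℝ x (momentVec m t) := by
    intro t
    simp [p, Polynomial.eval_finsetSum, momentVec, PiLp.inner_apply, mul_comm]
  refine ⟨p.roots.toFinset, ?_, fun t ht h => ht ?_⟩
  · exact (Multiset.toFinset_card_le _).trans ((Polynomial.card_roots' p).trans hdeg)
  · rw [Multiset.mem_toFinset, Polynomial.mem_roots hp, Polynomial.IsRoot, heval, h]

/-- A line contains at most one point of the moment curve. -/
lemma eq_div_of_mem_span_momentVec {m : ℕ} (hm : 1 ≤ m) {y : EuclideanSpace ℝ (Fin (m + 1))}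
    (hy : y ≠ 0) {t : ℝ} (h : y ∈ Submodule.span ℝ {momentVec m t}) :
    t = y ⟨1, by omega⟩ / y 0 := by
  obtain ⟨c, rfl⟩ := Submodule.mem_span_singleton.mp h
  have hc : c ≠ 0 := by
    rintro rfl
    simp at hy
  simp [momentVec, hc]

/-- The piecewise linear path from `x` to `d • y` through `⟪x, v⟫ • v`. -/
def linkVec {E : Type*} [NormedAddCommGroup E] [InnerProductSpace ℝ E] (v x y : E) (d t : ℝ) : E :=
  max (1 - 2 * t) 0 • x + (min t (1 - t) * inner ℝ x v) • v + (max (2 * t - 1) 0 * d) • y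

section LinkVec

variable {E : Type*} [NormedAddCommGroup E] [InnerProductSpace ℝ E]

lemma linkVec_neg_left (v x y : E) (d t : ℝ) :
    linkVec v (-x) y (-d) t = -linkVec v x y d t := by
  simp only [linkVec, inner_neg_left]
  module

lemma linkVec_neg_right (v x y : E) (d t : ℝ) :
    linkVec v x (-y) (-d) t = linkVec v x y d t := by
  simp only [linkVec]
  module

lemma linkVec_zero (v x y : E) (d : ℝ) : linkVec v x y d 0 = x := by
  simp [linkVec]

lemma linkVec_one (v x y : E) (d : ℝ) : linkVec v x y d 1 = d • y := by
  norm_num [linkVec]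

lemma linkVec_ne_zero {v x y : E} {d t : ℝ} (ht0 : 0 ≤ t) (ht1 : t ≤ 1)
    (hx : inner ℝ x v ≠ 0) (hd : d ≠ 0)
    (hy : y ∉ Submodule.span ℝ {v} ∨ 0 < inner ℝ x v * (d * inner ℝ y v)) :
    linkVec v x y d t ≠ 0 := by
  intro h
  have hv : v ≠ 0 := by
    rintro rfl
    simp at hx
  have hvv : 0 < inner ℝ v v := real_inner_self_pos.mpr hv
  have hxx : 0 < inner ℝ x v ^ 2 := by positivity
  have key : max (1 - 2 * t) 0 * inner ℝ x v ^ 2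
      + min t (1 - t) * (inner ℝ x v ^ 2 * inner ℝ v v)
      + max (2 * t - 1) 0 * (inner ℝ x v * (d * inner ℝ y v)) = 0 := by
    have := congrArg (fun w => inner ℝ x v * inner ℝ w v) h
    simp only [linkVec, inner_add_left, real_inner_smul_left, inner_zero_left, mul_zero] at this
    linarith
  have hb : 0 ≤ min t (1 - t) := le_min ht0 (by linarith)
  have hbv := mul_pos hxx hvv
  rcases lt_or_ge t (1 / 2) with hlt | hge
  · rw [max_eq_left (by linarith), max_eq_right (by linarith : 2 * t - 1 ≤ 0)] at key
    have h1 := mul_pos (by linarith : 0 < 1 - 2 * t) hxx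
    have h2 := mul_nonneg hb hbv.le
    linarith
  · rcases hge.eq_or_lt with rfl | hgt
    · norm_num at key
      rcases key with h' | h'
      · exact hx h'
      · exact hv h'
    · have hc : 0 < 2 * t - 1 := by linarith
      rcases hy with hy | hy
      · apply hy
        simp only [linkVec] at h
        rw [max_eq_right (by linarith : 1 - 2 * t ≤ 0), max_eq_left hc.le, zero_smul, zero_add] at h
        have hmem : ((2 * t - 1) * d) • y ∈ Submodule.span ℝ {v} := by
          rw [eq_neg_of_add_eq_zero_right h]
          exact Submodule.neg_mem _
            (Submodule.smul_mem _ _ (Submodule.mem_span_singleton_self v))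
        exact (Submodule.smul_mem_iff _ (mul_ne_zero hc.ne' hd)).mp hmem
      · rw [max_eq_right (by linarith), max_eq_left hc.le] at key
        have h1 := mul_pos hc hy
        have h2 := mul_nonneg hb hbv.le
        linarith

lemma continuous_linkVec {Y : Type*} [TopologicalSpace Y] (v : E) {x y : Y → E} {d t : Y → ℝ}
    (hx : Continuous x) (hy : Continuous y) (hd : Continuous d) (ht : Continuous t) :
    Continuous fun p => linkVec v (x p) (y p) (d p) (t p) := by
  unfold linkVec
  fun_prop

end LinkVec

section Quotient

variable {r : ℕ} {n : Fin r → ℕ}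

lemma ppsMk_eq_iff {x y : SphereProd n} : ppsMk n x = ppsMk n y ↔ y = x ∨ y = -x :=
  Quotient.eq

lemma isOpenQuotientMap_ppsMk : IsOpenQuotientMap (ppsMk n) := by
  refine ⟨Quotient.mk_surjective, continuous_quot_mk, fun U hU => ?_⟩
  have hpre : ppsMk n ⁻¹' (ppsMk n '' U) = U ∪ (fun x => -x) ⁻¹' U := by
    ext x
    constructor
    · rintro ⟨y, hy, hxy⟩
      rcases ppsMk_eq_iff.mp hxy with rfl | rfl
      · exact Or.inl hy
      · right
        simpa using hy
    · rintro (hx | hx)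
      · exact ⟨x, hx, rfl⟩
      · exact ⟨-x, hx, ppsMk_eq_iff.mpr (Or.inr (neg_neg x).symm)⟩
  have hq : Topology.IsQuotientMap (ppsMk n) := isQuotientMap_quot_mk
  rw [← hq.isOpen_preimage, hpre]
  exact hU.union (hU.preimage continuous_neg)

/-- A continuous family of paths in `S_{n̄}`, parametrized by an open set of pairs invariant under
both antipodal involutions and compatible with them, descends to a local motion planner. -/
lemma exists_section_of_lift {W : Set (SphereProd n × SphereProd n)}
    (hleft : ∀ x y, (x, y) ∈ W → (-x, y) ∈ W) (hright : ∀ x y, (x, y) ∈ W → (x, -y) ∈ W)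
    (hW : IsOpen W) (f : W × I → SphereProd n) (hf : Continuous f)
    (hfleft : ∀ x y (h : (x, y) ∈ W) t,
      f (⟨(-x, y), hleft x y h⟩, t) = -f (⟨(x, y), h⟩, t))
    (hfright : ∀ x y (h : (x, y) ∈ W) t,
      f (⟨(x, -y), hright x y h⟩, t) = f (⟨(x, y), h⟩, t))
    (hf0 : ∀ u : W, ppsMk n (f (u, 0)) = ppsMk n u.1.1)
    (hf1 : ∀ u : W, ppsMk n (f (u, 1)) = ppsMk n u.1.2) :
    ∃ U : Set (PPS n × PPS n), IsOpen U ∧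
      (∀ x y, (x, y) ∈ W → (ppsMk n x, ppsMk n y) ∈ U) ∧
      ∃ s : C(U, C(I, PPS n)), ∀ u : U, pathEval (PPS n) (s u) = (u : PPS n × PPS n) := by
  let π : SphereProd n × SphereProd n → PPS n × PPS n := Prod.map (ppsMk n) (ppsMk n)
  have hπ : IsOpenQuotientMap π := isOpenQuotientMap_ppsMk.prodMap isOpenQuotientMap_ppsMk
  have hmk_neg : ∀ x : SphereProd n, ppsMk n (-x) = ppsMk n x := fun x =>
    ppsMk_eq_iff.mpr (Or.inr (neg_neg x).symm)
  have hcompat : ∀ u v : W, π u = π v → ∀ t, ppsMk n (f (u, t)) = ppsMk n (f (v, t)) := by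
    rintro ⟨⟨x, y⟩, hu⟩ ⟨⟨x', y'⟩, hv⟩ h t
    obtain ⟨h1, h2⟩ := Prod.ext_iff.mp h
    rcases ppsMk_eq_iff.mp h1 with rfl | rfl <;>
      rcases ppsMk_eq_iff.mp h2 with rfl | rfl
    · rfl
    · rw [hfright _ _ hu]
    · rw [hfleft _ _ hu, hmk_neg]
    · rw [hfleft _ _ (hright _ _ hu), hfright _ _ hu, hmk_neg]
  let U := π '' W
  let ρ : W → U := fun u => ⟨π u, u, u.2, rfl⟩
  have hρ : IsOpenQuotientMap ρ := by
    refine ⟨?_, ?_, ?_⟩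
    · rintro ⟨_, w, hw, rfl⟩
      exact ⟨⟨w, hw⟩, rfl⟩
    · exact (hπ.continuous.comp continuous_subtype_val).subtype_mk _
    · have : IsOpenMap (fun u : W => π u) := hπ.isOpenMap.comp hW.isOpenMap_subtype_val
      exact this.subtype_mk _
  choose g hg using hρ.surjective
  have hρI : IsOpenQuotientMap (Prod.map ρ (id : I → I)) := hρ.prodMap IsOpenQuotientMap.id
  let F : U × I → PPS n := fun p => ppsMk n (f (g p.1, p.2))
  have hFρ : ∀ w t, F (ρ w, t) = ppsMk n (f (w, t)) := fun w t =>
    hcompat _ _ (congrArg Subtype.val (hg (ρ w))) t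
  have hF : Continuous F := by
    rw [hρI.isQuotientMap.continuous_iff]
    exact (isOpenQuotientMap_ppsMk.continuous.comp hf).congr fun p => (hFρ p.1 p.2).symm
  refine ⟨U, hπ.isOpenMap W hW, fun x y h => ⟨(x, y), h, rfl⟩, ContinuousMap.curry ⟨F, hF⟩, ?_⟩
  intro u
  obtain ⟨w, rfl⟩ := hρ.surjective u
  change (F (ρ w, 0), F (ρ w, 1)) = _
  rw [hFρ, hFρ, hf0, hf1]
  rfl

end Quotient

section Planner

variable {r : ℕ} {n : Fin r → ℕ}

/-- The pairs of points of `S_{n̄}` handled by the motion planner attached to `t`. -/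
def plannerDomain (n : Fin r → ℕ) (i₀ : Fin r) (t : ℝ) : Set (SphereProd n × SphereProd n) :=
  {p | (∀ i, inner ℝ (p.1 i).1 (momentVec (n i) t) ≠ 0) ∧
    inner ℝ (p.2 i₀).1 (momentVec (n i₀) t) ≠ 0 ∧
    ∀ i, i ≠ i₀ → (p.2 i).1 ∉ Submodule.span ℝ {momentVec (n i) t}}

/-- The bi-odd function whose sign chooses the lift of the target point. -/
def plannerSign (i₀ : Fin r) (t : ℝ) (p : SphereProd n × SphereProd n) : ℝ :=
  inner ℝ (p.1 i₀).1 (momentVec (n i₀) t) * inner ℝ (p.2 i₀).1 (momentVec (n i₀) t)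

lemma isOpen_plannerDomain (i₀ : Fin r) (t : ℝ) : IsOpen (plannerDomain n i₀ t) := by
  simp only [plannerDomain, Set.ofPred_and, Set.ofPred_forall]
  refine (isOpen_iInter_of_finite fun i => ?_).inter (IsOpen.inter ?_
    (isOpen_iInter_of_finite fun i => isOpen_iInter_of_finite fun _ => ?_))
  · exact isOpen_ne_fun (by fun_prop) continuous_const
  · exact isOpen_ne_fun (by fun_prop) continuous_const
  · exact (Submodule.closed_of_finiteDimensional
      (Submodule.span ℝ {momentVec (n i) t})).isOpen_compl.preimage
        (f := fun p : SphereProd n × SphereProd n => (p.2 i).1) (by fun_prop)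

lemma linkVec_ne_zero_of_mem_plannerDomain {i₀ : Fin r} {t : ℝ}
    {p : SphereProd n × SphereProd n} (hp : p ∈ plannerDomain n i₀ t) (s : I) (i : Fin r) :
    linkVec (momentVec (n i) t) (p.1 i).1 (p.2 i).1 (plannerSign i₀ t p) s ≠ 0 := by
  obtain ⟨hx, hy, hyi⟩ := hp
  have hd : plannerSign i₀ t p ≠ 0 := mul_ne_zero (hx i₀) hy
  refine linkVec_ne_zero s.2.1 s.2.2 (hx i) hd ?_
  by_cases hi : i = i₀
  · subst hi
    right
    have : 0 < plannerSign i t p ^ 2 := by positivity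
    calc 0 < plannerSign i t p ^ 2 := this
      _ = _ := by simp only [plannerSign]; ring
  · exact Or.inl (hyi i hi)

/-- The equivariant motion planner in `S_{n̄}` attached to `t`. -/
def plannerPath (i₀ : Fin r) (t : ℝ) (q : plannerDomain n i₀ t × I) : SphereProd n := fun i =>
  ⟨‖linkVec (momentVec (n i) t) (q.1.1.1 i).1 (q.1.1.2 i).1 (plannerSign i₀ t q.1.1) q.2‖⁻¹ •
      linkVec (momentVec (n i) t) (q.1.1.1 i).1 (q.1.1.2 i).1 (plannerSign i₀ t q.1.1) q.2, by
    rw [mem_sphere_zero_iff_norm, norm_smul, norm_inv, norm_norm]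
    exact inv_mul_cancel₀
      (norm_ne_zero_iff.mpr (linkVec_ne_zero_of_mem_plannerDomain q.1.2 q.2 i))⟩

lemma continuous_plannerPath (i₀ : Fin r) (t : ℝ) :
    Continuous (plannerPath (n := n) i₀ t) := by
  refine continuous_pi fun i => Continuous.subtype_mk ?_ _
  have hc : Continuous fun q : plannerDomain n i₀ t × I =>
      linkVec (momentVec (n i) t) (q.1.1.1 i).1 (q.1.1.2 i).1 (plannerSign i₀ t q.1.1) q.2 := by
    refine continuous_linkVec _ (by fun_prop) (by fun_prop) ?_ (by fun_prop)
    unfold plannerSign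
    fun_prop
  exact (hc.norm.inv₀ fun q =>
    norm_ne_zero_iff.mpr (linkVec_ne_zero_of_mem_plannerDomain q.1.2 q.2 i)).smul hc

lemma exists_section_plannerDomain (n : Fin r → ℕ) (i₀ : Fin r) (t : ℝ) :
    ∃ U : Set (PPS n × PPS n), IsOpen U ∧
      (∀ x y, (x, y) ∈ plannerDomain n i₀ t → (ppsMk n x, ppsMk n y) ∈ U) ∧
      ∃ s : C(U, C(I, PPS n)), ∀ u : U, pathEval (PPS n) (s u) = (u : PPS n × PPS n) := by
  refine exists_section_of_lift (W := plannerDomain n i₀ t) ?_ ?_ (isOpen_plannerDomain i₀ t)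
    (plannerPath i₀ t) (continuous_plannerPath i₀ t) ?_ ?_ ?_ ?_
  · rintro x y ⟨h1, h2, h3⟩
    exact ⟨fun i => by simpa using h1 i, h2, h3⟩
  · rintro x y ⟨h1, h2, h3⟩
    exact ⟨h1, by simpa using h2, fun i hi => by simpa using h3 i hi⟩
  · intro x y h s
    ext1 i
    apply Subtype.ext
    have : plannerSign i₀ t (-x, y) = -plannerSign i₀ t (x, y) := by simp [plannerSign]
    simp [plannerPath, this, linkVec_neg_left]
  · intro x y h s
    ext1 i
    apply Subtype.ext
    have : plannerSign i₀ t (x, -y) = -plannerSign i₀ t (x, y) := by simp [plannerSign]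
    simp [plannerPath, this, linkVec_neg_right]
  · rintro ⟨⟨x, y⟩, h⟩
    congr 1
    ext1 i
    apply Subtype.ext
    simp [plannerPath, linkVec_zero]
  · rintro ⟨⟨x, y⟩, h⟩
    have hd : plannerSign i₀ t (x, y) ≠ 0 := mul_ne_zero (h.1 i₀) h.2.1
    rw [ppsMk_eq_iff]
    rcases hd.lt_or_gt with hd | hd
    · right
      ext1 i
      apply Subtype.ext
      simp [plannerPath, linkVec_one, norm_smul, abs_of_neg hd, smul_smul, hd.ne, inv_neg]
    · left
      ext1 i
      apply Subtype.ext
      simp [plannerPath, linkVec_one, norm_smul, abs_of_pos hd, smul_smul, hd.ne']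

lemma exists_finset_mem_plannerDomain (hpos : ∀ i, 1 ≤ n i) (i₀ : Fin r) (x y : SphereProd n) :
    ∃ B : Finset ℝ, B.card ≤ 2 * n i₀ + ∑ i ∈ Finset.univ.erase i₀, (n i + 1) ∧
      ∀ t ∉ B, (x, y) ∈ plannerDomain n i₀ t := by
  classical
  have hne : ∀ (z : SphereProd n) i, (z i).1 ≠ 0 := fun z i => ne_zero_of_mem_unit_sphere (z i)
  choose B hB hBx using fun i => exists_finset_inner_momentVec_ne_zero (hne x i)
  obtain ⟨C, hC, hCy⟩ := exists_finset_inner_momentVec_ne_zero (hne y i₀)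
  refine ⟨(B i₀ ∪ C) ∪ (Finset.univ.erase i₀).biUnion fun i =>
    insert ((y i).1 ⟨1, by have := hpos i; omega⟩ / (y i).1 0) (B i), ?_, fun t ht => ?_⟩
  · refine (Finset.card_union_le _ _).trans (add_le_add ?_ ?_)
    · have := Finset.card_union_le (B i₀) C
      have := hB i₀
      omega
    · exact Finset.card_biUnion_le.trans (Finset.sum_le_sum fun i _ =>
        (Finset.card_insert_le _ _).trans (Nat.succ_le_succ (hB i)))
  · simp only [Finset.mem_union, Finset.mem_biUnion, Finset.mem_insert, Finset.mem_erase,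
      Finset.mem_univ, and_true, not_or, not_exists, not_and] at ht
    obtain ⟨⟨hti, htC⟩, ht⟩ := ht
    refine ⟨fun i => hBx i t ?_, hCy t htC, fun i hi h => (ht i hi).1 ?_⟩
    · by_cases hi : i = i₀
      · exact hi ▸ hti
      · exact (ht i hi).2
    · exact eq_div_of_mem_span_momentVec (hpos i) (hne y i) h

lemma tcCover_of_le (hpos : ∀ i, 1 ≤ n i) (i₀ : Fin r) {k : ℕ}
    (hk : 2 * n i₀ + ∑ i ∈ Finset.univ.erase i₀, (n i + 1) ≤ k) : TCCover (PPS n) k := by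
  classical
  choose U hUo hU hs using fun j : Fin (k + 1) =>
    exists_section_plannerDomain n i₀ ((j : ℕ) : ℝ)
  refine ⟨U, hUo, ?_, hs⟩
  rw [eq_univ_iff_forall]
  rintro ⟨p, q⟩
  obtain ⟨x, rfl⟩ := isOpenQuotientMap_ppsMk.surjective p
  obtain ⟨y, rfl⟩ := isOpenQuotientMap_ppsMk.surjective q
  obtain ⟨B, hB, hBmem⟩ := exists_finset_mem_plannerDomain hpos i₀ x y
  have hinj : Function.Injective fun j : Fin (k + 1) => ((j : ℕ) : ℝ) :=
    Nat.cast_injective.comp Fin.val_injective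
  have hcard : B.card < (Finset.univ.image fun j : Fin (k + 1) => ((j : ℕ) : ℝ)).card := by
    rw [Finset.card_image_of_injective _ hinj, Finset.card_univ, Fintype.card_fin]
    omega
  obtain ⟨t, ht, htB⟩ := Finset.exists_mem_notMem_of_card_lt_card hcard
  obtain ⟨j, -, rfl⟩ := Finset.mem_image.mp ht
  exact mem_iUnion.mpr ⟨j, hU j x y (hBmem _ htB)⟩

end Planner

/-- For `n̄ = (n₁,…,n_r)` with `1 ≤ n₁ ≤ ⋯ ≤ n_r` and `r ≥ 2`, the (reduced) topological
complexity of the projective product space satisfies `TC(P_{n̄}) ≤ 2|n̄| - n₁ + 1`,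
where `|n̄| = Σᵢ nᵢ = dim P_{n̄}`. -/
theorem stmt16 (r : ℕ) (hr : 2 ≤ r) (n : Fin r → ℕ)
    (hpos : ∀ i, 1 ≤ n i) (hmono : Monotone n) :
    topComplexity (PPS n) ≤
      ((2 * (∑ i, n i) - n ⟨0, by omega⟩ + 1 : ℕ) : ℕ∞) := by
  have hsum : n ⟨0, by omega⟩ + ∑ i ∈ Finset.univ.erase ⟨0, by omega⟩, n i = ∑ i, n i :=
    Finset.add_sum_erase _ _ (Finset.mem_univ _)
  have hcard : (Finset.univ.erase (⟨0, by omega⟩ : Fin r)).card = r - 1 := by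
    rw [Finset.card_erase_of_mem (Finset.mem_univ _), Finset.card_univ, Fintype.card_fin]
  have hmem : (⟨1, by omega⟩ : Fin r) ∈ Finset.univ.erase (⟨0, by omega⟩ : Fin r) := by simp
  have hsum' := Finset.add_sum_erase _ n hmem
  have hcard' := Finset.card_erase_of_mem hmem
  have hle : n ⟨0, by omega⟩ ≤ n ⟨1, by omega⟩ := hmono (by simp [Fin.le_def])
  have hrest : ((Finset.univ.erase (⟨0, by omega⟩ : Fin r)).erase ⟨1, by omega⟩).card ≤
      ∑ i ∈ (Finset.univ.erase (⟨0, by omega⟩ : Fin r)).erase ⟨1, by omega⟩, n i := by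
    rw [Finset.card_eq_sum_ones]
    exact Finset.sum_le_sum fun i _ => hpos i
  refine sInf_le ⟨_, tcCover_of_le hpos ⟨0, by omega⟩ ?_, rfl⟩
  rw [Finset.sum_add_distrib, Finset.sum_const]
  simp only [smul_eq_mul, mul_one] at *
  omega

end
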